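/- arXiv:1712.01255 — 2 statements merged into one kernel-verified Lean document; each statement's English description precedes it below -/
import Mathlib

section
/- Fix δ, ε, η > 0, k ∈ N, J₁ ∈ N, and constants 0 < α < 3b. There exists J₂ ∈ N such that for all sufficiently large n the following holds: for every function PT : R² × R² → [0,∞) satisfying the triangle inequality and satisfying α|x−y| ≤ PT(x,y) ≤ 3b|x−y| for all x, y ∈ Box(10n) with |x−y| ≥ √n, there exists j with J₁ ≤ j ≤ J₂ such that the number of lattice points z ∈ L-Box(n) that are not (δ, S¹(η), n/2^j, k)-Stable is at most ε·n². -/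
noncomputable section

/-- Euclidean norm on `ℝ²`. -/
def norm2 (p : ℝ × ℝ) : ℝ := Real.sqrt (p.1 ^ 2 + p.2 ^ 2)

/-- The box `[-r, r]² ⊆ ℝ²`. -/
def Box (r : ℝ) : Set (ℝ × ℝ) := {p | |p.1| ≤ r ∧ |p.2| ≤ r}

/-- The lattice box `[-r, r]² ∩ ℤ²`. -/
def LBox (r : ℝ) : Set (ℤ × ℤ) := {z | |(z.1 : ℝ)| ≤ r ∧ |(z.2 : ℝ)| ≤ r}

/-- The unit vector at angle `a`. -/
def dir (a : ℝ) : ℝ × ℝ := (Real.cos a, Real.sin a)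

/-- `z` is `(δ, θ, ℓ, k)`-stable for the distance function `D`: for every integer
`1 ≤ k' ≤ k`, `k'·D(z, z+ℓθ)/(1+δ) ≤ D(z, z+k'ℓθ) ≤ (1+δ)·k'·D(z, z+ℓθ)`. -/
def StablePt (D : ℝ × ℝ → ℝ × ℝ → ℝ) (δ : ℝ) (θ : ℝ × ℝ) (ℓ : ℝ) (k : ℝ)
    (z : ℝ × ℝ) : Prop :=
  ∀ k' : ℕ, 1 ≤ k' → (k' : ℝ) ≤ k →
    (k' : ℝ) * D z (z + ℓ • θ) / (1 + δ) ≤ D z (z + ((k' : ℝ) * ℓ) • θ) ∧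
      D z (z + ((k' : ℝ) * ℓ) • θ) ≤ (1 + δ) * (k' : ℝ) * D z (z + ℓ • θ)

/-- `z` is `(δ, S¹(η), ℓ, k)`-stable: it is `(δ, θ, ℓ, k)`-stable for every direction
`θ` in the discretized circle `S¹(η) = {0, η, 2η, …, 2π − η}`. -/
def StableDirs (D : ℝ × ℝ → ℝ × ℝ → ℝ) (δ η ℓ k : ℝ) (z : ℝ × ℝ) : Prop :=
  ∀ i : ℕ, (i : ℝ) * η ≤ 2 * Real.pi - η → StablePt D δ (dir ((i : ℝ) * η)) ℓ k z

/-- The gradient function `grad(z, θ, ℓ) = D(z, z + ℓθ)/ℓ`. -/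
def grad (D : ℝ × ℝ → ℝ × ℝ → ℝ) (z : ℝ × ℝ) (θ : ℝ × ℝ) (ℓ : ℝ) : ℝ :=
  D z (z + ℓ • θ) / ℓ

/-- `D : ℝ² × ℝ² → [0,∞)` satisfies the triangle inequality and the two-sided bound
`α|x−y| ≤ D(x,y) ≤ 3b|x−y|` for all `x, y ∈ Box(R)` with `|x−y| ≥ rt`. -/
def GoodPT' (α b R rt : ℝ) (D : ℝ × ℝ → ℝ × ℝ → ℝ) : Prop :=
  (∀ x y, 0 ≤ D x y) ∧
  (∀ x y z, D x z ≤ D x y + D y z) ∧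
  (∀ x y, x ∈ Box R → y ∈ Box R → rt ≤ norm2 (x - y) →
    α * norm2 (x - y) ≤ D x y ∧ D x y ≤ 3 * b * norm2 (x - y))

open Finset in
/-- A bounded-below energy drops by at most the average amount at some step. -/
lemma exists_step_le (E : ℕ → ℝ) (T : ℕ) (hT : 0 < T) (hE : 0 ≤ E T) :
    ∃ t < T, (T : ℝ) * (E t - E (t + 1)) ≤ E 0 := by
  by_contra! h
  have h1 : ∑ t ∈ range T, E 0 < ∑ t ∈ range T, (T : ℝ) * (E t - E (t + 1)) :=
    sum_lt_sum_of_nonempty (by simpa using hT.ne') fun t ht => h t (mem_range.1 ht)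
  rw [← mul_sum, sum_range_sub', sum_const, card_range, nsmul_eq_mul] at h1
  have hT' : (0 : ℝ) < T := by exact_mod_cast hT
  have := lt_of_mul_lt_mul_left h1 hT'.le
  linarith

/-- A chain of points satisfies the iterated triangle inequality. -/
lemma chain_le_sum (g : ℕ → ℕ → ℝ) (h3 : ∀ a b c, g a c ≤ g a b + g b c) (a m : ℕ) :
    g a (a + 1 + m) ≤ ∑ i ∈ Finset.range (m + 1), g (a + i) (a + i + 1) := by
  induction m with
  | zero => simp
  | succ m ih =>
    rw [Finset.sum_range_succ]
    refine (h3 a (a + 1 + m) _).trans (add_le_add ih (le_of_eq ?_))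
    congr 1 <;> ring

open Finset in
/-- The variance identity for a finite family. -/
lemma card_mul_sum_sq_sub (a : ℕ → ℝ) (M : ℕ) (hM : 0 < M) :
    (M : ℝ) * ∑ i ∈ range M, (a i - (∑ i ∈ range M, a i) / M) ^ 2
      = M * ∑ i ∈ range M, a i ^ 2 - (∑ i ∈ range M, a i) ^ 2 := by
  have hM' : (M : ℝ) ≠ 0 := by exact_mod_cast hM.ne'
  set S := ∑ i ∈ range M, a i with hS
  have : ∑ i ∈ range M, (a i - S / M) ^ 2
      = ∑ i ∈ range M, a i ^ 2 - 2 * (S / M) * S + M * (S / M) ^ 2 := by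
    simp only [sub_sq, sum_add_distrib, sum_sub_distrib, sum_const, card_range, nsmul_eq_mul]
    congr 2
    rw [hS, mul_sum]
    exact sum_congr rfl fun i _ => by ring
  rw [this]
  field_simp
  ring

open Finset in
/-- The energy defect of a chain of `M` points is nonnegative. -/
lemma chain_defect_nonneg (g : ℕ → ℕ → ℝ) (h0 : ∀ a b, 0 ≤ g a b)
    (h3 : ∀ a b c, g a c ≤ g a b + g b c) (M : ℕ) (hM : 0 < M) :
    0 ≤ (M : ℝ) * ∑ i ∈ range M, g i (i + 1) ^ 2 - g 0 M ^ 2 := by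
  have h1 := card_mul_sum_sq_sub (fun i => g i (i + 1)) M hM
  have h2 : g 0 M ≤ ∑ i ∈ range M, g i (i + 1) := by
    obtain ⟨m, rfl⟩ := Nat.exists_eq_add_of_lt hM
    simpa [add_comm] using chain_le_sum g h3 0 m
  have h4 : g 0 M ^ 2 ≤ (∑ i ∈ range M, g i (i + 1)) ^ 2 := by
    gcongr; exact h0 _ _
  have h5 : 0 ≤ (M : ℝ) * ∑ i ∈ range M, (g i (i + 1) - (∑ i ∈ range M, g i (i + 1)) / M) ^ 2 :=
    by positivity
  linarith

open Finset in
/-- A chain of `M` points with small energy defect is almost linear. -/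
lemma chain_near_linear (g : ℕ → ℕ → ℝ) (h0 : ∀ a b, 0 ≤ g a b)
    (h3 : ∀ a b c, g a c ≤ g a b + g b c) (M : ℕ) (β : ℝ) (hβ : 0 ≤ β)
    (hdef : (M : ℝ) * ∑ i ∈ range M, g i (i + 1) ^ 2 - g 0 M ^ 2 ≤ β ^ 2)
    (k : ℕ) (hk : 1 ≤ k) (hkM : k ≤ M) :
    |g 0 k - k * g 0 1| ≤ 3 * M * β := by
  have hM : 0 < M := by omega
  have hM1 : (1 : ℝ) ≤ M := by exact_mod_cast hM
  have hkr : (1 : ℝ) ≤ k := by exact_mod_cast hk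
  have hkMr : (k : ℝ) ≤ M := by exact_mod_cast hkM
  have h1 := card_mul_sum_sq_sub (fun i => g i (i + 1)) M hM
  set S := ∑ i ∈ range M, g i (i + 1) with hS
  have hsum : ∀ k, 1 ≤ k → g 0 k ≤ ∑ i ∈ range k, g i (i + 1) := by
    intro k hk
    obtain ⟨m, rfl⟩ := Nat.exists_eq_add_of_le' hk
    simpa [add_comm] using chain_le_sum g h3 0 m
  have hxS := hsum M hM
  have hx0 := h0 0 M
  rw [← hS] at hxS
  have hV : 0 ≤ (M : ℝ) * ∑ i ∈ range M, (g i (i + 1) - S / M) ^ 2 := by positivity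
  have hgap : S - g 0 M ≤ β := by
    refine (abs_le.1 (abs_le_of_sq_le_sq ?_ hβ)).2
    nlinarith
  have hS2 : g 0 M ^ 2 ≤ S ^ 2 := by gcongr
  have hdev : ∀ i < M, |g i (i + 1) - S / M| ≤ β := by
    intro i hi
    apply abs_le_of_sq_le_sq _ hβ
    have := single_le_sum (f := fun i => (g i (i + 1) - S / M) ^ 2)
      (fun i _ => sq_nonneg _) (mem_range.2 hi)
    have h6 : ∑ i ∈ range M, (g i (i + 1) - S / M) ^ 2
        ≤ M * ∑ i ∈ range M, (g i (i + 1) - S / M) ^ 2 :=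
      le_mul_of_one_le_left (sum_nonneg fun i _ => sq_nonneg _) hM1
    linarith
  have ha : ∀ i < M, |g i (i + 1) - g 0 1| ≤ 2 * β := by
    intro i hi
    have e1 := abs_le.1 (hdev i hi)
    have e2 := abs_le.1 (hdev 0 hM)
    rw [zero_add] at e2
    rw [abs_le]; constructor <;> linarith
  have hP : |∑ i ∈ range k, g i (i + 1) - k * g 0 1| ≤ k * (2 * β) := by
    have : ∑ i ∈ range k, g i (i + 1) - k * g 0 1 = ∑ i ∈ range k, (g i (i + 1) - g 0 1) := by
      simp
    rw [this]
    refine (abs_sum_le_sum_abs _ _).trans ((sum_le_sum fun i hi =>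
      ha i ((mem_range.1 hi).trans_le hkM)).trans ?_)
    simp
  have hlow : ∑ i ∈ range k, g i (i + 1) - β ≤ g 0 k := by
    rcases hkM.eq_or_lt with rfl | hlt
    · linarith
    · obtain ⟨m, rfl⟩ := Nat.exists_eq_add_of_lt hlt
      have e1 := chain_le_sum g h3 k m
      have e2 := h3 0 k (k + m + 1)
      rw [add_assoc k m 1, sum_range_add] at hS
      rw [show k + 1 + m = k + m + 1 by ring] at e1
      linarith
  have e := abs_le.1 hP
  have := hsum k hk
  have h7 : (k : ℝ) * β ≤ M * β := by gcongr
  have h8 : β ≤ M * β := le_mul_of_one_le_left hβ hM1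
  rw [abs_le]; constructor <;> nlinarith

open Finset in
/-- Sums of a nonnegative function over translates of `B` inside `A`. -/
lemma sum_translates_le {G : Type*} [AddCommGroup G] (A B : Finset G) (f : G → ℝ)
    (hf : ∀ z, 0 ≤ f z) (M : ℕ) (v : ℕ → G) (h : ∀ z ∈ B, ∀ i < M, z + v i ∈ A) :
    ∑ z ∈ B, ∑ i ∈ range M, f (z + v i) ≤ M * ∑ z ∈ A, f z := by
  classical
  rw [sum_comm]
  have : ∀ i ∈ range M, ∑ z ∈ B, f (z + v i) ≤ ∑ z ∈ A, f z := by
    intro i hi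
    rw [← sum_image (s := B) (g := fun z => z + v i) (f := f)
      (fun x _ y _ hxy => add_right_cancel hxy)]
    refine sum_le_sum_of_subset_of_nonneg ?_ fun z _ _ => hf z
    intro w hw
    obtain ⟨z, hz, rfl⟩ := mem_image.1 hw
    exact h z hz i (mem_range.1 hi)
  simpa using sum_le_sum this

open Finset in
/-- Among the scales `M ^ t`, `t < T`, there is one at which, outside a small exceptional set,
a (possibly asymmetric) metric is almost linear along each of the given directions. -/
lemma exists_linear_scale {G I : Type*} [AddCommGroup G] (ι : Finset I) (u : I → G)
    (d : G → G → ℝ) (h0 : ∀ x y, 0 ≤ d x y) (h3 : ∀ x y z, d x z ≤ d x y + d y z)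
    (M T : ℕ) (hM : 0 < M) (hT : 0 < T) (A : ℕ → Finset G)
    (hA : ∀ t < T, ∀ θ ∈ ι, ∀ z ∈ A (t + 1), ∀ i < M, z + (i * M ^ t) • u θ ∈ A t)
    (C : ℝ) (hC : ∀ θ ∈ ι, ∀ z ∈ A 0, d z (z + u θ) ≤ C) (β : ℝ) (hβ : 0 ≤ β) :
    ∃ t < T, ∃ B : Finset G,
      (T : ℝ) * (β ^ 2 * #B) ≤ M ^ 2 * (#ι * (#(A 0) * C ^ 2)) ∧
      ∀ z ∈ A (t + 1), z ∉ B → ∀ θ ∈ ι, ∀ k : ℕ, 1 ≤ k → k ≤ M →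
        |d z (z + (k * M ^ t) • u θ) - k * d z (z + (M ^ t) • u θ)| ≤ 3 * M * β * M ^ t := by
  classical
  have hMr : (0 : ℝ) < M := by exact_mod_cast hM
  set F : ℕ → I → G → ℝ := fun t θ z => d z (z + (M ^ t) • u θ) / M ^ t with hF
  set E : ℕ → ℝ := fun t => ∑ θ ∈ ι, ∑ z ∈ A t, F t θ z ^ 2 with hE
  set g : ℕ → I → G → ℕ → ℕ → ℝ := fun t θ z a b =>
    d (z + (a * M ^ t) • u θ) (z + (b * M ^ t) • u θ) / M ^ t with hg
  set df : ℕ → I → G → ℝ := fun t θ z =>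
    (M : ℝ) * ∑ i ∈ range M, g t θ z i (i + 1) ^ 2 - g t θ z 0 M ^ 2 with hdf
  have hg0 : ∀ t θ z a b, 0 ≤ g t θ z a b := fun t θ z a b => by
    simp only [hg]; exact div_nonneg (h0 _ _) (by positivity)
  have hg3 : ∀ t θ z a b c, g t θ z a c ≤ g t θ z a b + g t θ z b c := fun t θ z a b c => by
    simp only [hg]
    rw [← add_div]
    gcongr
    exact h3 _ _ _
  have hdf0 : ∀ t θ z, 0 ≤ df t θ z := fun t θ z =>
    chain_defect_nonneg _ (hg0 t θ z) (hg3 t θ z) M hM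
  obtain ⟨t, htT, ht⟩ := exists_step_le E T hT (by simp only [hE]; positivity)
  have hgF : ∀ θ z i, g t θ z i (i + 1) = F t θ (z + (i * M ^ t) • u θ) := by
    intro θ z i
    simp only [hg, hF]
    rw [add_mul, one_mul, add_smul, add_assoc]
  have hgF' : ∀ θ z, g t θ z 0 M = M * F (t + 1) θ z := by
    intro θ z
    simp only [hg, hF, zero_mul, zero_smul, add_zero, pow_succ']
    field_simp
  have hinc : ∑ θ ∈ ι, ∑ z ∈ A (t + 1), df t θ z ≤ M ^ 2 * (E t - E (t + 1)) := by
    simp only [hE]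
    rw [← sum_sub_distrib, mul_sum]
    refine sum_le_sum fun θ hθ => ?_
    simp only [hdf, hgF, hgF', mul_pow]
    rw [sum_sub_distrib, ← mul_sum, ← mul_sum, mul_sub]
    have := sum_translates_le (A t) (A (t + 1)) (fun z => F t θ z ^ 2) (fun z => sq_nonneg _) M
      (fun i => (i * M ^ t) • u θ) (hA t htT θ hθ)
    have := mul_le_mul_of_nonneg_left this hMr.le
    linarith
  have hE0 : E 0 ≤ #ι * (#(A 0) * C ^ 2) := by
    simp only [hE]
    rw [← nsmul_eq_mul, ← nsmul_eq_mul]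
    refine sum_le_card_nsmul _ _ _ fun θ hθ => sum_le_card_nsmul _ _ _ fun z hz => ?_
    simp only [hF, pow_zero, div_one, one_smul]
    exact pow_le_pow_left₀ (h0 _ _) (hC θ hθ z hz) 2
  refine ⟨t, htT, {z ∈ A (t + 1) | β ^ 2 < ∑ θ ∈ ι, df t θ z}, ?_, ?_⟩
  · have h1 : β ^ 2 * #{z ∈ A (t + 1) | β ^ 2 < ∑ θ ∈ ι, df t θ z}
        ≤ M ^ 2 * (E t - E (t + 1)) := by
      refine le_trans ?_ hinc
      rw [sum_comm, mul_comm, ← nsmul_eq_mul]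
      refine (card_nsmul_le_sum _ (fun z => ∑ θ ∈ ι, df t θ z) _
        fun z hz => (mem_filter.1 hz).2.le).trans ?_
      exact sum_le_sum_of_subset_of_nonneg (filter_subset _ _)
        fun z _ _ => sum_nonneg fun θ _ => hdf0 t θ z
    calc _ ≤ (T : ℝ) * (M ^ 2 * (E t - E (t + 1))) := by gcongr
      _ = M ^ 2 * (T * (E t - E (t + 1))) := by ring
      _ ≤ M ^ 2 * (#ι * (#(A 0) * C ^ 2)) := by
        exact mul_le_mul_of_nonneg_left (ht.trans hE0) (by positivity)
  · intro z hz hzB θ hθ k hk hkM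
    have hs : ∑ θ ∈ ι, df t θ z ≤ β ^ 2 := by
      by_contra! h
      exact hzB (mem_filter.2 ⟨hz, h⟩)
    have h1 : df t θ z ≤ β ^ 2 :=
      (single_le_sum (f := fun θ => df t θ z) (fun θ _ => hdf0 t θ z) hθ).trans hs
    have h2 := chain_near_linear _ (hg0 t θ z) (hg3 t θ z) M β hβ h1 k hk hkM
    simp only [hg, zero_mul, zero_smul, add_zero, one_mul] at h2
    have hMt : (0 : ℝ) < M ^ t := by positivity
    rwa [← mul_div_assoc, ← sub_div, abs_div, abs_of_pos hMt, div_le_iff₀ hMt] at h2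

lemma norm2_smul_dir (r a : ℝ) (hr : 0 ≤ r) (x : ℝ × ℝ) : norm2 (x - (x + r • dir a)) = r := by
  have : (x - (x + r • dir a)).1 ^ 2 + (x - (x + r • dir a)).2 ^ 2 = r ^ 2 := by
    simp only [dir, Prod.fst_sub, Prod.fst_add, Prod.smul_fst, Prod.snd_sub, Prod.snd_add,
      Prod.smul_snd, smul_eq_mul]
    nlinarith [Real.sin_sq_add_cos_sq a]
  rw [norm2, this, Real.sqrt_sq hr]

/-- Detour bound: nearby points are at distance `O(√n)`. -/
lemma GoodPT'.le_of_close {α b R ρ : ℝ} {D : ℝ × ℝ → ℝ × ℝ → ℝ} (hD : GoodPT' α b R ρ D)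
    (hb : 0 ≤ b) (hρ : 0 ≤ ρ) {x y : ℝ × ℝ} (hx : x ∈ Box (R - 2 * ρ)) (hy : y ∈ Box R)
    (h1 : |x.1 - y.1| ≤ ρ) (h2 : |x.2 - y.2| ≤ ρ) : D x y ≤ 18 * b * ρ := by
  obtain ⟨-, h3, hB⟩ := hD
  set q : ℝ × ℝ := (x.1 + 2 * ρ, x.2) with hq
  obtain ⟨hx1, hx2⟩ := hx
  rw [abs_le] at hx1 hx2 h1 h2
  have hxR : x ∈ Box R := ⟨abs_le.2 ⟨by linarith, by linarith⟩, abs_le.2 ⟨by linarith, by linarith⟩⟩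
  have hqR : q ∈ Box R := ⟨abs_le.2 ⟨by simp only [hq]; linarith, by simp only [hq]; linarith⟩,
    abs_le.2 ⟨by simp only [hq]; linarith, by simp only [hq]; linarith⟩⟩
  have e1 : norm2 (x - q) = 2 * ρ := by
    have : (x - q).1 ^ 2 + (x - q).2 ^ 2 = (2 * ρ) ^ 2 := by simp [hq]
    rw [norm2, this, Real.sqrt_sq (by linarith)]
  have hq1 : (q - y).1 = 2 * ρ + (x.1 - y.1) := by simp [hq]; ring
  have hq2 : (q - y).2 = x.2 - y.2 := by simp [hq]
  have e2 : ρ ≤ norm2 (q - y) := by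
    rw [norm2, hq1, hq2]
    exact Real.le_sqrt_of_sq_le (by nlinarith [sq_nonneg (x.2 - y.2)])
  have e3 : norm2 (q - y) ≤ 4 * ρ := by
    rw [norm2, hq1, hq2, Real.sqrt_le_left (by linarith)]
    nlinarith
  have e4 := (hB x q hxR hqR (by rw [e1]; linarith)).2
  have e5 := (hB q y hqR hy e2).2
  rw [e1] at e4
  have e6 : 3 * b * norm2 (q - y) ≤ 3 * b * (4 * ρ) := by gcongr
  linarith [h3 x q y]

/-- The lattice box as a finset. -/
def latticeBox (r : ℝ) : Finset (ℤ × ℤ) := Finset.Icc (-⌊r⌋) ⌊r⌋ ×ˢ Finset.Icc (-⌊r⌋) ⌊r⌋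

lemma mem_latticeBox {r : ℝ} {z : ℤ × ℤ} :
    z ∈ latticeBox r ↔ |(z.1 : ℝ)| ≤ r ∧ |(z.2 : ℝ)| ≤ r := by
  have : ∀ a : ℤ, (-⌊r⌋ ≤ a ∧ a ≤ ⌊r⌋) ↔ |(a : ℝ)| ≤ r := by
    intro a
    rw [neg_le, Int.le_floor, Int.le_floor, abs_le, neg_le (a := r)]
    push_cast
    rfl
  rw [latticeBox, Finset.mem_product, Finset.mem_Icc, Finset.mem_Icc, this, this]

lemma card_latticeBox_le {r : ℝ} (hr : 0 ≤ r) : ((latticeBox r).card : ℝ) ≤ (2 * r + 1) ^ 2 := by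
  have h0 : 0 ≤ ⌊r⌋ := Int.floor_nonneg.2 hr
  have h1 : ((⌊r⌋ + 1 - -⌊r⌋).toNat : ℝ) = 2 * (⌊r⌋ : ℝ) + 1 := by
    have : ((⌊r⌋ + 1 - -⌊r⌋).toNat : ℤ) = 2 * ⌊r⌋ + 1 := by omega
    exact_mod_cast this
  have h2 : (0 : ℝ) ≤ ⌊r⌋ := by exact_mod_cast h0
  rw [latticeBox, Finset.card_product, Int.card_Icc, Nat.cast_mul, h1, ← sq]
  gcongr
  exact Int.floor_le r

lemma within_factor {δ X Y c κ : ℝ} (hδ : 0 < δ) (hκ : 1 ≤ κ) (hc : 0 < c) (hY : c ≤ Y)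
    (h : |X - κ * Y| ≤ δ / (1 + δ) * c) :
    κ * Y / (1 + δ) ≤ X ∧ X ≤ (1 + δ) * κ * Y := by
  have hδ1 : 0 < 1 + δ := by linarith
  have hcY : c ≤ κ * Y := hY.trans (le_mul_of_one_le_left (hc.le.trans hY) hκ)
  have h1 : δ / (1 + δ) * c ≤ δ / (1 + δ) * (κ * Y) := by gcongr
  have h2 : κ * Y / (1 + δ) = κ * Y - δ / (1 + δ) * (κ * Y) := by field_simp; ring
  have h3 : δ / (1 + δ) * (κ * Y) ≤ δ * (κ * Y) := by
    have : δ / (1 + δ) ≤ δ := div_le_self hδ.le (by linarith)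
    exact mul_le_mul_of_nonneg_right this (hc.le.trans hcY)
  have h4 := abs_le.1 h
  constructor
  · linarith
  · linarith

lemma abs_floor_sub_le (x : ℝ) : |(⌊x⌋ : ℝ) - x| ≤ 1 := by
  have h1 := Int.floor_le x
  have h2 := Int.lt_floor_add_one x
  rw [abs_le]; constructor <;> linarith

lemma abs_mul_le_left {a c : ℝ} (ha : 0 ≤ a) (hc : |c| ≤ 1) : |a * c| ≤ a := by
  rw [abs_mul, abs_of_nonneg ha]
  exact mul_le_of_le_one_right ha hc

lemma Box_mono {R R' : ℝ} (h : R ≤ R') : Box R ⊆ Box R' :=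
  fun _ hp => ⟨hp.1.trans h, hp.2.trans h⟩

lemma add_smul_dir_mem_Box {R a : ℝ} {p : ℝ × ℝ} (hp : p ∈ Box R) (φ : ℝ) (ha : 0 ≤ a) :
    p + a • dir φ ∈ Box (R + a) :=
  ⟨(abs_add_le _ _).trans (add_le_add hp.1 (abs_mul_le_left ha (Real.abs_cos_le_one φ))),
    (abs_add_le _ _).trans (add_le_add hp.2 (abs_mul_le_left ha (Real.abs_sin_le_one φ)))⟩

lemma GoodPT'.bounds_along_dir {α b R ρ : ℝ} {D : ℝ × ℝ → ℝ × ℝ → ℝ} (hD : GoodPT' α b R ρ D)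
    {p : ℝ × ℝ} {a : ℝ} (hp : p ∈ Box (R - a)) (φ : ℝ) (ha : 0 ≤ a) (hρ : ρ ≤ a) :
    α * a ≤ D p (p + a • dir φ) ∧ D p (p + a • dir φ) ≤ 3 * b * a := by
  have hn := norm2_smul_dir a φ ha p
  have hq := add_smul_dir_mem_Box hp φ ha
  rw [sub_add_cancel] at hq
  have := hD.2.2 p (p + a • dir φ) (Box_mono (by linarith) hp) hq (by rwa [hn])
  rwa [hn] at this

/-- The lattice point `z` seen in the plane. -/
def toPlane (z : ℤ × ℤ) : ℝ × ℝ := ((z.1 : ℝ), (z.2 : ℝ))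

/-- The lattice vector obtained by rounding down `s • dir φ`. -/
def roundDir (s φ : ℝ) : ℤ × ℤ := (⌊s * Real.cos φ⌋, ⌊s * Real.sin φ⌋)

lemma toPlane_add_smul_roundDir (z : ℤ × ℤ) (m : ℕ) (s φ : ℝ) :
    toPlane (z + m • roundDir s φ) =
      ((z.1 : ℝ) + m * (⌊s * Real.cos φ⌋ : ℝ), (z.2 : ℝ) + m * (⌊s * Real.sin φ⌋ : ℝ)) := by
  simp [toPlane, roundDir]

/-- Replacing a ray by its rounded lattice version changes distances by `O(ρ)`. -/
lemma GoodPT'.lattice_ray_close {α b R ρ : ℝ} {D : ℝ × ℝ → ℝ × ℝ → ℝ} (hD : GoodPT' α b R ρ D)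
    (hb : 0 ≤ b) {z : ℤ × ℤ} {m : ℕ} {s φ : ℝ} (hs : 0 ≤ s)
    (hz : toPlane z ∈ Box (R - 3 * ρ - m * s)) (hm : m ≤ ρ) :
    |D (toPlane z) (toPlane (z + m • roundDir s φ))
      - D (toPlane z) (toPlane z + (m * s) • dir φ)| ≤ 18 * b * ρ := by
  have hm0 : (0 : ℝ) ≤ m := Nat.cast_nonneg m
  have hp := add_smul_dir_mem_Box hz φ (mul_nonneg hm0 hs)
  rw [sub_add_cancel] at hp
  set p := toPlane z + (m * s) • dir φ with hpdef
  set q := toPlane (z + m • roundDir s φ) with hqdef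
  have hdiff : ∀ y w : ℝ, |y + m * (⌊w⌋ : ℝ) - (y + m * w)| ≤ ρ := by
    intro y w
    rw [add_sub_add_left_eq_sub, ← mul_sub, abs_mul, abs_of_nonneg hm0]
    have := mul_le_mul_of_nonneg_left (abs_floor_sub_le w) hm0
    linarith
  have h1 : |q.1 - p.1| ≤ ρ := by
    have := hdiff z.1 (s * Real.cos φ)
    rwa [← mul_assoc, mul_assoc, show (z.1 : ℝ) + m * (s * Real.cos φ) = p.1 by
      simp [hpdef, toPlane, dir, mul_assoc], show (z.1 : ℝ) + m * (⌊s * Real.cos φ⌋ : ℝ) = q.1 by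
      rw [hqdef, toPlane_add_smul_roundDir]] at this
  have h2 : |q.2 - p.2| ≤ ρ := by
    have := hdiff z.2 (s * Real.sin φ)
    rwa [← mul_assoc, mul_assoc, show (z.2 : ℝ) + m * (s * Real.sin φ) = p.2 by
      simp [hpdef, toPlane, dir, mul_assoc], show (z.2 : ℝ) + m * (⌊s * Real.sin φ⌋ : ℝ) = q.2 by
      rw [hqdef, toPlane_add_smul_roundDir]] at this
  have hρ : 0 ≤ ρ := hm0.trans hm
  have hq : q ∈ Box (R - 2 * ρ) := by
    have e1 := abs_le.1 h1
    have e2 := abs_le.1 h2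
    have e3 := abs_le.1 hp.1
    have e4 := abs_le.1 hp.2
    refine ⟨abs_le.2 ⟨?_, ?_⟩, abs_le.2 ⟨?_, ?_⟩⟩ <;> linarith
  have e1 := hD.le_of_close hb hρ hq (Box_mono (by linarith) hp) h1 h2
  rw [abs_sub_comm] at h1 h2
  have e2 := hD.le_of_close hb hρ (Box_mono (by linarith) hp) (Box_mono (by linarith) hq) h1 h2
  have e3 := hD.2.1 (toPlane z) q p
  have e4 := hD.2.1 (toPlane z) p q
  rw [abs_le]; constructor <;> linarith

/-- A translate of a lattice box by a multiple of a rounded vector lies in a larger box. -/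
lemma add_smul_roundDir_mem_latticeBox {r s φ : ℝ} (hs : 1 ≤ s) {z : ℤ × ℤ}
    (hz : z ∈ latticeBox r) (m : ℕ) : z + m • roundDir s φ ∈ latticeBox (r + m * (2 * s)) := by
  have hstep : ∀ y c : ℝ, |y| ≤ r → |c| ≤ 1 → |y + m * (⌊s * c⌋ : ℝ)| ≤ r + m * (2 * s) := by
    intro y c hy hc
    have h1 := abs_le.1 (abs_floor_sub_le (s * c))
    have h2 := abs_le.1 (abs_mul_le_left (by linarith : 0 ≤ s) hc)
    have h3 : |(⌊s * c⌋ : ℝ)| ≤ 2 * s := by rw [abs_le]; constructor <;> linarith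
    refine (abs_add_le _ _).trans (add_le_add hy ?_)
    rw [abs_mul, Nat.abs_cast]
    gcongr
  obtain ⟨hz1, hz2⟩ := mem_latticeBox.1 hz
  have e := toPlane_add_smul_roundDir z m s φ
  rw [Prod.ext_iff] at e
  refine mem_latticeBox.2 ⟨?_, ?_⟩
  · exact (congrArg abs e.1).trans_le (hstep _ _ hz1 (Real.abs_cos_le_one φ))
  · exact (congrArg abs e.2).trans_le (hstep _ _ hz2 (Real.abs_sin_le_one φ))

/-- A good metric is almost linear at one of the lengths `M ^ t * s`, `t < T`, along finitely many
directions, at all lattice points of a box outside a small exceptional set. -/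
lemma GoodPT'.exists_linear_scale {α b x r : ℝ} {D : ℝ × ℝ → ℝ × ℝ → ℝ}
    (hD : GoodPT' α b (10 * x) r D) (hb : 0 ≤ b) (η : ℝ) (ι : Finset ℕ) {M T : ℕ} (hM : 0 < M)
    (hT : 0 < T) {s β : ℝ} (hβ : 0 ≤ β) (hr : 1 ≤ r) (hrs : 6 * r ≤ s) (hMs : M ^ T * s ≤ x)
    (hMr : M ^ T ≤ r) :
    ∃ t < T, ∃ B : Finset (ℤ × ℤ),
      T * β ^ 2 * B.card ≤ M ^ 2 * (ι.card * (121 * (6 * b) ^ 2)) * x ^ 2 ∧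
      ∀ z ∈ latticeBox x, z ∉ B → ∀ i ∈ ι, ∀ k : ℕ, 1 ≤ k → k ≤ M →
        |D (toPlane z) (toPlane z + (k * (M ^ t * s)) • dir (i * η))
          - k * D (toPlane z) (toPlane z + (M ^ t * s) • dir (i * η))|
          ≤ 3 * M * β * (M ^ t * s) + (M + 1) * (18 * b * r) := by
  have hM1 : (1 : ℝ) ≤ M := by exact_mod_cast hM
  have hs0 : 0 < s := by linarith
  have hMt : ∀ t ≤ T, (M : ℝ) ^ t * s ≤ x ∧ (M : ℝ) ^ t ≤ r := fun t ht => by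
    have h1 : (M : ℝ) ^ t ≤ M ^ T := pow_le_pow_right₀ hM1 ht
    exact ⟨(mul_le_mul_of_nonneg_right h1 hs0.le).trans hMs, h1.trans hMr⟩
  have hsx : s ≤ x := by simpa using (hMt 0 (Nat.zero_le _)).1
  have hMt0 : ∀ t, (0 : ℝ) < (M : ℝ) ^ t * s := fun t => by positivity
  set A : ℕ → Finset (ℤ × ℤ) := fun t => latticeBox (5 * x - 3 * (M ^ t * s))
  have hclose : ∀ z : ℤ × ℤ, toPlane z ∈ Box (5 * x) → ∀ i m : ℕ, (m : ℝ) ≤ r → m * s ≤ x →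
      |D (toPlane z) (toPlane (z + m • roundDir s (i * η)))
        - D (toPlane z) (toPlane z + (m * s) • dir (i * η))| ≤ 18 * b * r :=
    fun z hz i m hm hms =>
      hD.lattice_ray_close hb hs0.le (Box_mono (by linarith) hz) hm
  have hA5 : ∀ t, ∀ z ∈ A t, toPlane z ∈ Box (5 * x) := fun t z hz =>
    Box_mono (by linarith [hMt0 t]) (mem_latticeBox.1 hz)
  have hA_mono : ∀ t < T, ∀ i ∈ ι, ∀ z ∈ A (t + 1), ∀ a < M,
      z + (a * M ^ t) • roundDir s (i * η) ∈ A t := by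
    intro t ht i hi z hz a ha
    have h1 := mem_latticeBox.1
      (add_smul_roundDir_mem_latticeBox (s := s) (φ := i * η) (by linarith) hz (a * M ^ t))
    have haM : (a : ℝ) + 1 ≤ M := by exact_mod_cast ha
    have h2 := mul_le_mul_of_nonneg_right haM (hMt0 t).le
    have h3 := mul_le_mul_of_nonneg_right hM1 (hMt0 t).le
    have h4 : 5 * x - 3 * ((M : ℝ) ^ (t + 1) * s) + ((a * M ^ t : ℕ) : ℝ) * (2 * s)
        ≤ 5 * x - 3 * ((M : ℝ) ^ t * s) := by
      push_cast
      rw [pow_succ]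
      linarith
    exact mem_latticeBox.2 ⟨h1.1.trans h4, h1.2.trans h4⟩
  have hstart : ∀ i ∈ ι, ∀ z ∈ A 0,
      D (toPlane z) (toPlane (z + roundDir s (i * η))) ≤ 6 * b * s := by
    intro i _ z hz
    have e1 := hclose z (hA5 0 z hz) i 1 (by simpa using hr) (by simpa using hsx)
    have e2 := (hD.bounds_along_dir (a := s) (Box_mono (by linarith) (hA5 0 z hz)) (i * η) hs0.le
      (by linarith)).2
    simp only [Nat.cast_one, one_mul, one_smul] at e1
    have e3 := abs_le.1 e1
    have e4 := mul_le_mul_of_nonneg_left hrs hb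
    linarith
  obtain ⟨t, htT, B, hBcard, hBgood⟩ := _root_.exists_linear_scale ι (fun i => roundDir s (i * η))
    (fun z w => D (toPlane z) (toPlane w)) (fun _ _ => hD.1 _ _) (fun _ _ _ => hD.2.1 _ _ _) M T hM
    hT A hA_mono (6 * b * s) hstart (β * s) (by positivity)
  refine ⟨t, htT, B, ?_, fun z hz hzB i hi k hk hkM => ?_⟩
  · have hA0 : ((A 0).card : ℝ) ≤ 121 * x ^ 2 := by
      refine (card_latticeBox_le ?_).trans ?_
      · rw [pow_zero, one_mul]; linarith
      · rw [pow_zero, one_mul, show 121 * x ^ 2 = (11 * x) ^ 2 by ring]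
        exact pow_le_pow_left₀ (by linarith) (by linarith) 2
    refine le_of_mul_le_mul_left ?_ (pow_pos hs0 2)
    calc s ^ 2 * (T * β ^ 2 * B.card) = T * ((β * s) ^ 2 * B.card) := by ring
      _ ≤ M ^ 2 * (ι.card * ((A 0).card * (6 * b * s) ^ 2)) := hBcard
      _ ≤ M ^ 2 * (ι.card * (121 * x ^ 2 * (6 * b * s) ^ 2)) := by gcongr
      _ = _ := by ring
  · have hT1 := hMt (t + 1) htT
    have hT0 := hMt t htT.le
    have hzA : z ∈ A (t + 1) := by
      obtain ⟨hz1, hz2⟩ := mem_latticeBox.1 hz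
      exact mem_latticeBox.2 ⟨by linarith, by linarith⟩
    have hz5 := hA5 _ z hzA
    have hkr : (k : ℝ) ≤ M := by exact_mod_cast hkM
    have hlin := hBgood z hzA hzB i hi k hk hkM
    have hcast : ((k * M ^ t : ℕ) : ℝ) ≤ M ^ (t + 1) := by
      push_cast; rw [pow_succ']; gcongr
    have c1 := hclose z hz5 i (k * M ^ t) (hcast.trans hT1.2)
      ((mul_le_mul_of_nonneg_right hcast hs0.le).trans hT1.1)
    have c2 := hclose z hz5 i (M ^ t) (by push_cast; exact hT0.2) (by push_cast; exact hT0.1)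
    push_cast at c1 c2
    rw [mul_assoc] at c1
    have hkb : k * (18 * b * r) ≤ M * (18 * b * r) := by gcongr
    have a1 := abs_le.1 c1
    have a2 := abs_le.1 c2
    have a3 := abs_le.1 hlin
    have a4 := mul_le_mul_of_nonneg_left a2.1 (Nat.cast_nonneg (α := ℝ) k)
    have a5 := mul_le_mul_of_nonneg_left a2.2 (Nat.cast_nonneg (α := ℝ) k)
    rw [abs_le]
    constructor <;> linarith

/-- stability for general bi-Lipschitz distance functions. Fix
`δ, ε, η > 0`, `k`, `J₁` and `0 < α < 3b`. There exists `J₂` such that for all large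
`n` and every `D` satisfying the triangle inequality and `α|x−y| ≤ D(x,y) ≤ 3b|x−y|`
for `x, y ∈ Box(10n)` with `|x−y| ≥ √n`, there is `J₁ ≤ j ≤ J₂` with at most `εn²`
points of `L-Box(n)` failing to be `(δ, S¹(η), n/2^j, k)`-stable. -/
theorem stability_general_metric
    (δ ε η : ℝ) (k J₁ : ℕ) (α b : ℝ)
    (hδ : 0 < δ) (hε : 0 < ε) (hη : 0 < η) (hk : 1 ≤ k) (hα : 0 < α)
    (hab : α < 3 * b) :
    ∃ J₂ : ℕ, ∃ N : ℕ, ∀ n : ℕ, N ≤ n →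
    ∀ D : ℝ × ℝ → ℝ × ℝ → ℝ, GoodPT' α b (10 * n) (Real.sqrt n) D →
    ∃ j : ℕ, J₁ ≤ j ∧ j ≤ J₂ ∧
      (({z : ℤ × ℤ | z ∈ LBox n ∧
          ¬ StableDirs D δ η ((n : ℝ) / 2 ^ j) (k : ℝ)
            ((z.1 : ℝ), (z.2 : ℝ))}).ncard : ℝ) ≤ ε * (n : ℝ) ^ 2 := by
  set M : ℕ := 2 ^ k with hMdef
  have hkM : k ≤ M := Nat.lt_two_pow_self.le
  have hM : 0 < M := by positivity
  have hMr : (1 : ℝ) ≤ M := by exact_mod_cast hM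
  have hb : 0 < b := by linarith
  set β : ℝ := δ * α / (6 * M * (1 + δ)) with hβdef
  have hβ : 0 < β := by positivity
  set ι : Finset ℕ := Finset.range (⌊2 * Real.pi / η⌋₊ + 1) with hι
  set W : ℝ := M ^ 2 * (ι.card * (121 * (6 * b) ^ 2)) with hW
  set T : ℕ := ⌈W / (β ^ 2 * ε)⌉₊ + 1 with hTdef
  have hT : 0 < T := by omega
  have hTW : W ≤ T * (β ^ 2 * ε) := by
    rw [← div_le_iff₀ (by positivity), hTdef]
    push_cast
    linarith [Nat.le_ceil (W / (β ^ 2 * ε))]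
  set J : ℕ := J₁ + k * T with hJ
  set Q : ℝ := (M + 1) * (18 * b) * 2 ^ J * (2 * (1 + δ)) / (δ * α) with hQ
  have hQ0 : 0 < Q := by positivity
  refine ⟨J, ⌈(6 * 2 ^ J + Q) ^ 2⌉₊, fun n hn D hD => ?_⟩
  have h2J : (1 : ℝ) ≤ 2 ^ J := one_le_pow₀ (by norm_num)
  set r : ℝ := √(n : ℝ) with hr
  have hrr : r * r = n := Real.mul_self_sqrt (Nat.cast_nonneg n)
  have hrQ : 6 * 2 ^ J + Q ≤ r := Real.le_sqrt_of_sq_le (Nat.ceil_le.1 hn)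
  have hr6 : 6 ≤ r := by linarith
  set x : ℝ := (n : ℝ) with hx
  set s : ℝ := x / 2 ^ J with hs
  have hsJ : s * 2 ^ J = x := div_mul_cancel₀ _ (by positivity)
  have hrs : 6 * r ≤ s := by
    rw [hs, le_div_iff₀ (by positivity), ← hrr]
    nlinarith
  have hMT : (M : ℝ) ^ T * 2 ^ J₁ = 2 ^ J := by
    rw [hJ, hMdef]; push_cast; rw [← pow_mul, pow_add, mul_comm]
  have hs0 : 0 < s := by linarith
  have hMTJ : (M : ℝ) ^ T ≤ 2 ^ J := by
    rw [← hMT]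
    exact le_mul_of_one_le_right (by positivity) (one_le_pow₀ (by norm_num))
  have hMTs : (M : ℝ) ^ T * s ≤ x := by
    rw [← hsJ, mul_comm s]
    gcongr
  have hMTr : (M : ℝ) ^ T ≤ r := by linarith
  obtain ⟨t, htT, B, hBcard, hBgood⟩ :=
    hD.exists_linear_scale hb.le η ι hM hT hβ.le (by linarith) hrs hMTs hMTr
  have hkt : k * t ≤ k * T := Nat.mul_le_mul_left k htT.le
  refine ⟨J - k * t, by omega, by omega, ?_⟩
  have hℓ : x / 2 ^ (J - k * t) = M ^ t * s := by
    have : (2 : ℝ) ^ J = 2 ^ (J - k * t) * M ^ t := by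
      rw [hMdef]; push_cast; rw [← pow_mul, ← pow_add]; congr 1; omega
    rw [hs, this, hMdef]
    field_simp
  have hsℓ : s ≤ M ^ t * s := le_mul_of_one_le_left hs0.le (one_le_pow₀ hMr)
  have hℓx : M ^ t * s ≤ x :=
    (mul_le_mul_of_nonneg_right (pow_le_pow_right₀ hMr htT.le) hs0.le).trans hMTs
  have herr : 3 * M * β * (M ^ t * s) + (M + 1) * (18 * b * r)
      ≤ δ / (1 + δ) * (α * (M ^ t * s)) := by
    have e1 : (M + 1) * (18 * b * r) = δ * α / (2 * (1 + δ)) * (Q * r / 2 ^ J) := by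
      rw [hQ]; field_simp
    have e2 : Q * r / 2 ^ J ≤ M ^ t * s := by
      refine le_trans ?_ hsℓ
      rw [hs, ← hrr]
      gcongr
      linarith
    have e3 : 3 * M * β = δ * α / (2 * (1 + δ)) := by
      rw [hβdef]; field_simp; norm_num
    have e4 : δ / (1 + δ) * (α * (M ^ t * s)) = δ * α / (2 * (1 + δ)) * (M ^ t * s)
        + δ * α / (2 * (1 + δ)) * (M ^ t * s) := by field_simp; norm_num
    rw [e1, e3, e4]
    gcongr
  have hsub : {z : ℤ × ℤ | z ∈ LBox x ∧
      ¬ StableDirs D δ η (x / 2 ^ (J - k * t)) (k : ℝ) ((z.1 : ℝ), (z.2 : ℝ))} ⊆ ↑B := by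
    rintro z ⟨hz, hbad⟩
    by_contra hzB
    refine hbad fun i hi k' hk' hk'k => ?_
    rw [hℓ]
    have hiι : i ∈ ι := by
      rw [hι, Finset.mem_range, Nat.lt_succ_iff]
      refine Nat.le_floor ?_
      rw [le_div_iff₀ hη]
      linarith
    have hY := (hD.bounds_along_dir (p := toPlane z) (a := M ^ t * s)
      (Box_mono (by linarith) (show toPlane z ∈ Box x from hz)) (i * η) (by positivity)
      (by linarith)).1
    exact within_factor hδ (by exact_mod_cast hk') (by positivity) hY
      ((hBgood z (mem_latticeBox.2 hz) hzB i hiι k' hk'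
        (le_trans (by exact_mod_cast hk'k) hkM)).trans herr)
  have hcard : ({z : ℤ × ℤ | z ∈ LBox x ∧
      ¬ StableDirs D δ η (x / 2 ^ (J - k * t)) (k : ℝ) ((z.1 : ℝ), (z.2 : ℝ))}.ncard : ℝ)
      ≤ B.card := by
    rw [← Set.ncard_coe_finset B]
    exact_mod_cast Set.ncard_le_ncard hsub B.finite_toSet
  refine hcard.trans ?_
  have hTr : (0 : ℝ) < T := by exact_mod_cast hT
  refine le_of_mul_le_mul_left ?_ (show 0 < T * β ^ 2 by positivity)
  calc T * β ^ 2 * (B.card : ℝ) ≤ W * x ^ 2 := hBcard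
    _ ≤ T * (β ^ 2 * ε) * x ^ 2 := by gcongr
    _ = T * β ^ 2 * (ε * x ^ 2) := by ring
end
end

section
/- Fix constants 0 < α < b, a point z ∈ Box(n), a unit direction θ, k ∈ N, δ₂ > 0 and J₁ ∈ N. Then there exist 𝔪 ∈ N and a constant C depending only on α and b such that for all sufficiently small δ₃ > 0 and all sufficiently large n the following holds for every function PT as in the hypotheses: there exists j ∈ N with J₁ ≤ j ≤ J₁ + δ₃^{−2} such that at most a C·δ₂ fraction of the points z_i := z + i·(n/2^{j𝔪})·θ, for 0 ≤ i ≤ 2^{j𝔪}, fail to be (δ₂, θ, n/2^{j𝔪}, k)-Stable. -/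
noncomputable section

theorem dist_le_add_nsmul_of_steps {X : Type*} {D : X → X → ℝ}
    (tri : ∀ x y z, D x z ≤ D x y + D y z) (x : ℕ → X) (w : X) (c : ℝ) (p q : ℕ)
    (h : ∀ s, p ≤ s → s < p + q → D (x s) (x (s + 1)) ≤ c) :
    D w (x (p + q)) ≤ D w (x p) + q * c := by
  induction q with
  | zero => simp
  | succ q ih =>
    have h1 := ih fun s hs hs' => h s hs (by omega)
    have h2 := h (p + q) (by omega) (by omega)
    have h3 := tri w (x (p + q)) (x (p + q + 1))
    push_cast
    rw [← add_assoc]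
    linarith

theorem dist_le_nsmul_add_of_steps {X : Type*} {D : X → X → ℝ}
    (tri : ∀ x y z, D x z ≤ D x y + D y z) (x : ℕ → X) (w : X) (c : ℝ) (p q : ℕ)
    (h : ∀ s, p ≤ s → s < p + q → D (x s) (x (s + 1)) ≤ c) :
    D (x p) w ≤ q * c + D (x (p + q)) w := by
  induction q with
  | zero => simp
  | succ q ih =>
    have h1 := ih fun s hs hs' => h s hs (by omega)
    have h2 := h (p + q) (by omega) (by omega)
    have h3 := tri (x (p + q)) (x (p + q + 1)) w
    push_cast
    rw [← add_assoc]
    linarith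

theorem dist_le_sum_steps {X : Type*} {D : X → X → ℝ}
    (tri : ∀ x y z, D x z ≤ D x y + D y z) (x : ℕ → X) (p M : ℕ) (hM : 1 ≤ M) :
    D (x p) (x (p + M)) ≤ ∑ r ∈ Finset.range M, D (x (p + r)) (x (p + r + 1)) := by
  induction M, hM using Nat.le_induction with
  | base => simp
  | succ M _ ih =>
    rw [Finset.sum_range_succ]
    have := tri (x p) (x (p + M)) (x (p + M + 1))
    rw [← add_assoc]
    linarith

theorem sum_range_mul_eq_sum_sum (g : ℕ → ℝ) (A M : ℕ) :
    ∑ i ∈ Finset.range (A * M), g i =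
      ∑ a ∈ Finset.range A, ∑ r ∈ Finset.range M, g (a * M + r) := by
  induction A with
  | zero => simp
  | succ A ih => rw [Nat.succ_mul, Finset.sum_range_add, ih, Finset.sum_range_succ]

/-- One step of the energy increment argument for a nonnegative submartingale. -/
theorem sum_sq_sub_le (f g : ℕ → ℝ) (A M : ℕ) (hf : ∀ a < A, 0 ≤ f a)
    (hfg : ∀ a < A, M * f a ≤ ∑ r ∈ Finset.range M, g (a * M + r)) :
    ∑ a ∈ Finset.range A, ∑ r ∈ Finset.range M, (g (a * M + r) - f a) ^ 2 ≤
      ∑ i ∈ Finset.range (A * M), g i ^ 2 - M * ∑ a ∈ Finset.range A, f a ^ 2 := by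
  rw [sum_range_mul_eq_sum_sum, Finset.mul_sum, ← Finset.sum_sub_distrib]
  refine Finset.sum_le_sum fun a ha => ?_
  have ha := Finset.mem_range.1 ha
  have h1 : ∑ r ∈ Finset.range M, (g (a * M + r) - f a) ^ 2 =
      ∑ r ∈ Finset.range M, g (a * M + r) ^ 2
        - 2 * f a * ∑ r ∈ Finset.range M, g (a * M + r) + M * f a ^ 2 := by
    simp only [sub_sq, Finset.sum_add_distrib, Finset.sum_sub_distrib, Finset.sum_const,
      Finset.card_range, nsmul_eq_mul, Finset.mul_sum]
    congr 2
    exact Finset.sum_congr rfl fun _ _ => by ring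
  rw [h1]
  nlinarith [mul_le_mul_of_nonneg_left (hfg a ha) (hf a ha)]

theorem exists_increment_le (E : ℕ → ℝ) (K : ℝ) (J T : ℕ) (hT : 1 ≤ T) (h0 : 0 ≤ E J)
    (hK : E (J + T) ≤ K) : ∃ t < T, E (J + t + 1) - E (J + t) ≤ K / T := by
  have hT' : (0 : ℝ) < T := by exact_mod_cast hT
  have hs : ∑ t ∈ Finset.range T, (E (J + t + 1) - E (J + t)) ≤
      ∑ _t ∈ Finset.range T, K / T := by
    have := Finset.sum_range_sub (fun t => E (J + t)) T
    simp only [add_zero, ← add_assoc] at this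
    rw [this, Finset.sum_const, Finset.card_range, nsmul_eq_mul, mul_div_cancel₀ _ hT'.ne']
    linarith
  obtain ⟨t, ht, h⟩ := Finset.exists_le_of_sum_le (Finset.nonempty_range_iff.2 (by omega)) hs
  exact ⟨t, Finset.mem_range.1 ht, h⟩

theorem card_filter_exists_mul_sq_le (g : ℕ → ℕ → ℝ) (A M : ℕ) (η : ℝ) (hη : 0 ≤ η) :
    (((Finset.range A).filter fun a => ∃ r < M, η < |g a r|).card : ℝ) * η ^ 2 ≤
      ∑ a ∈ Finset.range A, ∑ r ∈ Finset.range M, g a r ^ 2 := by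
  rw [← nsmul_eq_mul]
  refine (Finset.card_nsmul_le_sum _ (fun a => ∑ r ∈ Finset.range M, g a r ^ 2) _ ?_).trans
    (Finset.sum_le_sum_of_subset_of_nonneg (Finset.filter_subset _ _)
      fun a _ _ => Finset.sum_nonneg fun r _ => sq_nonneg _)
  intro a ha
  obtain ⟨r, hr, h⟩ := (Finset.mem_filter.1 ha).2
  calc η ^ 2 ≤ |g a r| ^ 2 := by gcongr
    _ = g a r ^ 2 := sq_abs _
    _ ≤ _ := Finset.single_le_sum (f := fun r => g a r ^ 2) (fun r _ => sq_nonneg _)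
      (Finset.mem_range.2 hr)

/-- A set of positions in `[0, A * M]` avoiding every index `a * M + r` with `a ∉ S` and
`r + k ≤ M` has at most `#S * M + A * k + 1` elements. -/
theorem ncard_le_of_block_cover (P : ℕ → Prop) (S : Finset ℕ) (A M k : ℕ) (hM : 1 ≤ M)
    (hP : ∀ a < A, a ∉ S → ∀ r, r + k ≤ M → r < M → ¬ P (a * M + r)) :
    {i : ℕ | i ≤ A * M ∧ P i}.ncard ≤ S.card * M + A * k + 1 := by
  classical
  let F : Finset ℕ := (S ×ˢ Finset.range M).image (fun p => p.1 * M + p.2) ∪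
    (Finset.range A ×ˢ Finset.range k).image (fun p => p.1 * M + (M - 1 - p.2)) ∪ {A * M}
  have hsub : {i : ℕ | i ≤ A * M ∧ P i} ⊆ (F : Set ℕ) := by
    rintro i ⟨hi, hPi⟩
    rcases hi.eq_or_lt with rfl | hi
    · simp [F]
    have hr : i % M < M := Nat.mod_lt _ hM
    have ha : i / M < A := (Nat.div_lt_iff_lt_mul hM).2 hi
    have hdm : i / M * M + i % M = i := Nat.div_add_mod' i M
    simp only [F, Finset.coe_union, Set.mem_union, Finset.mem_coe, Finset.mem_image,
      Finset.mem_product, Finset.mem_range, Prod.exists]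
    left
    by_cases hS : i / M ∈ S
    · exact Or.inl ⟨i / M, i % M, ⟨hS, hr⟩, hdm⟩
    · refine Or.inr ⟨i / M, M - 1 - i % M, ⟨ha, ?_⟩, ?_⟩
      · by_contra hk
        exact hP _ ha hS (i % M) (by omega) hr (hdm.symm ▸ hPi)
      · rw [show M - 1 - (M - 1 - i % M) = i % M by omega, hdm]
  calc {i : ℕ | i ≤ A * M ∧ P i}.ncard ≤ (F : Set ℕ).ncard :=
        Set.ncard_le_ncard hsub F.finite_toSet
    _ = F.card := Set.ncard_coe_finset F
    _ ≤ S.card * M + A * k + 1 := by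
      refine (Finset.card_union_le _ _).trans (Nat.add_le_add ?_ (by simp))
      refine (Finset.card_union_le _ _).trans (Nat.add_le_add ?_ ?_) <;>
      · refine Finset.card_image_le.trans ?_
        simp

/-- If the consecutive distances of `x p, …, x (p + M)` all nearly equal the average distance
`u * ℓ` of the endpoints, then multi-step distances are nearly multiples of one-step ones. -/
theorem stable_of_steps_near {X : Type*} {D : X → X → ℝ}
    (tri : ∀ x y z, D x z ≤ D x y + D y z) (x : ℕ → X) (p M : ℕ) (ℓ u η δ : ℝ)
    (hℓ : 0 ≤ ℓ) (hη : 0 ≤ η) (hδ : 0 < δ)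
    (hu : D (x p) (x (p + M)) = M * (u * ℓ)) (hηu : η * (1 + (1 + δ) * M) ≤ δ * u)
    (hstep : ∀ s < M, |D (x (p + s)) (x (p + s + 1)) - u * ℓ| ≤ η * ℓ)
    (r k' : ℕ) (hk' : 1 ≤ k') (hr : r + k' ≤ M) :
    k' * D (x (p + r)) (x (p + r + 1)) / (1 + δ) ≤ D (x (p + r)) (x (p + r + k')) ∧
      D (x (p + r)) (x (p + r + k')) ≤ (1 + δ) * k' * D (x (p + r)) (x (p + r + 1)) := by
  have hle : ∀ s, p ≤ s → s < p + M → D (x s) (x (s + 1)) ≤ (u + η) * ℓ := by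
    intro s hs hs'
    obtain ⟨t, rfl⟩ := Nat.exists_eq_add_of_le hs
    linarith [(abs_le.1 (hstep t (by omega))).2]
  obtain ⟨q, rfl⟩ := Nat.exists_eq_add_of_le hr
  have hk : (1 : ℝ) ≤ k' := by exact_mod_cast hk'
  have hq : (0 : ℝ) ≤ q := by positivity
  have hr0 : (0 : ℝ) ≤ r := by positivity
  have habs := abs_le.1 (hstep r (by omega))
  set v := D (x (p + r)) (x (p + r + 1)) with hv
  constructor
  · have h1 := dist_le_nsmul_add_of_steps tri x (x (p + (r + k' + q))) ((u + η) * ℓ) p r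
      fun s hs hs' => hle s hs (by omega)
    have h2 := dist_le_add_nsmul_of_steps tri x (x (p + r)) ((u + η) * ℓ) (p + r + k') q
      fun s hs hs' => hle s (by omega) (by omega)
    rw [show p + r + k' + q = p + (r + k' + q) by ring] at h2
    rw [hu] at h1
    push_cast at h1 hηu
    rw [div_le_iff₀ (by positivity)]
    have h3 : k' * (u * ℓ) - (r + q) * (η * ℓ) ≤ D (x (p + r)) (x (p + r + k')) := by
      linarith
    have h4 : (k' : ℝ) * v ≤ k' * ((u + η) * ℓ) := by gcongr; linarith
    have h5 : (k' * u - (r + q) * η) * (1 + δ) * ℓ ≤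
        D (x (p + r)) (x (p + r + k')) * (1 + δ) := by nlinarith
    have h6 : k' * (u + η) ≤ (k' * u - (r + q) * η) * (1 + δ) := by
      have e1 : 0 ≤ (k' - 1) * (δ * u - η * (1 + (1 + δ) * (r + k' + q))) :=
        mul_nonneg (by linarith) (by linarith)
      have e2 : 0 ≤ η * (1 + δ) * (k' * (r + k' + q) - (r + q)) :=
        mul_nonneg (by positivity) (by nlinarith)
      nlinarith
    nlinarith [mul_le_mul_of_nonneg_right h6 hℓ]
  · have h1 := dist_le_add_nsmul_of_steps tri x (x (p + r)) ((u + η) * ℓ) (p + r + 1) (k' - 1)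
      fun s hs hs' => hle s (by omega) (by omega)
    rw [show p + r + 1 + (k' - 1) = p + r + k' by omega, Nat.cast_sub hk'] at h1
    push_cast at h1 hηu
    have h3 : (u + η) * ℓ ≤ (1 + δ) * v := by
      have e1 : 0 ≤ η * (1 + δ) * (r + k' + q - 1) := mul_nonneg (by positivity) (by linarith)
      have e2 : u + η ≤ (1 + δ) * (u - η) := by nlinarith
      nlinarith [mul_le_mul_of_nonneg_right e2 hℓ,
        mul_le_mul_of_nonneg_left (show (u - η) * ℓ ≤ v by linarith)
          (show 0 ≤ 1 + δ by linarith)]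
    have hv0 : v ≤ (1 + δ) * v := by
      have : 0 ≤ v := by
        have e3 : 0 ≤ u - η := by
          have : 0 ≤ η * (1 + δ) * (r + k' + q - 1) := mul_nonneg (by positivity) (by linarith)
          nlinarith
        nlinarith [mul_nonneg e3 hℓ]
      nlinarith
    nlinarith [mul_le_mul_of_nonneg_left h3 (show (0 : ℝ) ≤ k' - 1 by linarith)]

theorem norm2_smul (t : ℝ) (p : ℝ × ℝ) : norm2 (t • p) = |t| * norm2 p := by
  simp only [norm2, Prod.smul_fst, Prod.smul_snd, smul_eq_mul]
  rw [← Real.sqrt_sq_eq_abs, ← Real.sqrt_mul (sq_nonneg t)]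
  ring_nf

theorem abs_fst_le_norm2 (p : ℝ × ℝ) : |p.1| ≤ norm2 p :=
  Real.abs_le_sqrt (by nlinarith [sq_nonneg p.2])

theorem abs_snd_le_norm2 (p : ℝ × ℝ) : |p.2| ≤ norm2 p :=
  Real.abs_le_sqrt (by nlinarith [sq_nonneg p.1])

theorem add_smul_mem_Box {n t : ℝ} {z θ : ℝ × ℝ} (hz : z ∈ Box n) (hθ : norm2 θ = 1)
    (ht : 0 ≤ t) (htn : t ≤ n) : z + t • θ ∈ Box (10 * n) := by
  have h1 := abs_fst_le_norm2 θ
  have h2 := abs_snd_le_norm2 θ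
  rw [hθ] at h1 h2
  have hn : 0 ≤ n := ht.trans htn
  constructor
  · calc |z.1 + t * θ.1| ≤ |z.1| + |t| * |θ.1| := (abs_add_le _ _).trans_eq (by rw [abs_mul])
      _ ≤ n + n * 1 := by rw [abs_of_nonneg ht]; gcongr; exact hz.1
      _ ≤ 10 * n := by linarith
  · calc |z.2 + t * θ.2| ≤ |z.2| + |t| * |θ.2| := (abs_add_le _ _).trans_eq (by rw [abs_mul])
      _ ≤ n + n * 1 := by rw [abs_of_nonneg ht]; gcongr; exact hz.2
      _ ≤ 10 * n := by linarith

theorem GoodPT'.step_bounds {α b n rt ℓ t : ℝ} {D : ℝ × ℝ → ℝ × ℝ → ℝ}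
    (hD : GoodPT' α b (10 * n) rt D) {z θ : ℝ × ℝ} (hz : z ∈ Box n) (hθ : norm2 θ = 1)
    (hℓ : 0 ≤ ℓ) (hrt : rt ≤ ℓ) (ht : 0 ≤ t) (htn : t + ℓ ≤ n) :
    α * ℓ ≤ D (z + t • θ) (z + (t + ℓ) • θ) ∧
      D (z + t • θ) (z + (t + ℓ) • θ) ≤ 3 * b * ℓ := by
  have h : norm2 (z + t • θ - (z + (t + ℓ) • θ)) = ℓ := by
    rw [show z + t • θ - (z + (t + ℓ) • θ) = (-ℓ) • θ by module, norm2_smul, hθ, abs_neg,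
      abs_of_nonneg hℓ, mul_one]
  have := hD.2.2 _ _ (add_smul_mem_Box hz hθ ht (by linarith))
    (add_smul_mem_Box hz hθ (by positivity) htn) (h.symm ▸ hrt)
  rwa [h] at this

/-- stability on a fixed line. There exist `𝔪 ∈ ℕ` and a constant
`C = C(α,b)` such that for all sufficiently small `δ₃ > 0` and all sufficiently large
`n`: for every admissible `D`, `z ∈ Box(n)` and unit direction `θ`, there exists
`J₁ ≤ j ≤ J₁ + δ₃^{−2}` such that at most a `C·δ₂` fraction of the points
`z_i = z + i·(n/2^{j𝔪})·θ`, `0 ≤ i ≤ 2^{j𝔪}`, fail to be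
`(δ₂, θ, n/2^{j𝔪}, k)`-stable. -/
theorem stability_on_a_line
    (α b : ℝ) (hα : 0 < α) (hab : α < b) :
    ∃ Cc : ℝ, 0 < Cc ∧
    ∀ (k : ℕ) (δ₂ : ℝ) (J₁ : ℕ), 1 ≤ k → 0 < δ₂ →
    ∃ 𝔪 : ℕ, 1 ≤ 𝔪 ∧ ∃ δ₀ : ℝ, 0 < δ₀ ∧ ∀ δ₃ : ℝ, 0 < δ₃ → δ₃ ≤ δ₀ →
    ∃ N : ℕ, ∀ n : ℕ, N ≤ n →
    ∀ D : ℝ × ℝ → ℝ × ℝ → ℝ, GoodPT' α b (10 * n) (Real.sqrt n) D →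
    ∀ z ∈ Box (n : ℝ), ∀ θ : ℝ × ℝ, norm2 θ = 1 →
    ∃ j : ℕ, J₁ ≤ j ∧ (j : ℝ) ≤ (J₁ : ℝ) + 1 / δ₃ ^ 2 ∧
      (({i : ℕ | i ≤ 2 ^ (j * 𝔪) ∧
          ¬ StablePt D δ₂ θ ((n : ℝ) / 2 ^ (j * 𝔪)) (k : ℝ)
            (z + ((i : ℝ) * ((n : ℝ) / 2 ^ (j * 𝔪))) • θ)}).ncard : ℝ) ≤
        Cc * δ₂ * ((2 : ℝ) ^ (j * 𝔪) + 1) := by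
  refine ⟨3, by norm_num, fun k δ₂ J₁ hk hδ => ?_⟩
  obtain ⟨𝔪, h𝔪⟩ := pow_unbounded_of_one_lt ((k : ℝ) / δ₂ + 1) (one_lt_two (α := ℝ))
  have hk1 : (1 : ℝ) ≤ k := by exact_mod_cast hk
  obtain ⟨M, hM⟩ : ∃ M : ℕ, M = 2 ^ 𝔪 := ⟨_, rfl⟩
  have hMr : (M : ℝ) = 2 ^ 𝔪 := by rw [hM]; push_cast; rfl
  have hM1 : 1 ≤ M := hM ▸ Nat.one_le_two_pow
  have hM0 : (0 : ℝ) < M := by exact_mod_cast hM1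
  have hMk : k ≤ δ₂ * M := by
    rw [hMr, mul_comm, ← div_le_iff₀ hδ]; linarith
  obtain ⟨η, hη⟩ : ∃ η : ℝ, η = δ₂ * α / (1 + (1 + δ₂) * M) := ⟨_, rfl⟩
  have hη0 : 0 < η := by rw [hη]; positivity
  obtain ⟨T, hT⟩ := exists_nat_ge (M * (3 * b) ^ 2 / (η ^ 2 * δ₂) + 1)
  have hb : 0 < b := hα.trans hab
  have hT1 : 1 ≤ T := by
    have : (1 : ℝ) ≤ T := le_trans (le_add_of_nonneg_left (by positivity)) hT
    exact_mod_cast this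
  have hT0 : (0 : ℝ) < T := by exact_mod_cast hT1
  refine ⟨𝔪, ?_, 1 / T, by positivity, fun δ₃ hδ₃ hδ₃T => ⟨4 ^ ((J₁ + T) * 𝔪), ?_⟩⟩
  · rcases Nat.eq_zero_or_pos 𝔪 with rfl | h
    · have : 0 < (k : ℝ) / δ₂ := by positivity
      norm_num at h𝔪; linarith
    · exact h
  intro n hn D hD z hz θ hθ
  have hTδ : (T : ℝ) ≤ 1 / δ₃ ^ 2 := by
    rw [le_div_iff₀ (by positivity)]
    have h1 : δ₃ * T ≤ 1 := by rwa [le_div_iff₀ hT0] at hδ₃T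
    have h2 : (1 : ℝ) ≤ T := by exact_mod_cast hT1
    have h3 : δ₃ ≤ 1 := by nlinarith
    nlinarith
  have hn0 : (0 : ℝ) < n := by
    exact_mod_cast (show 0 < n from lt_of_lt_of_le (by positivity) hn)
  let ℓ : ℕ → ℝ := fun j => (n : ℝ) / 2 ^ (j * 𝔪)
  let x : ℕ → ℕ → ℝ × ℝ := fun j i => z + ((i : ℝ) * ℓ j) • θ
  let f : ℕ → ℕ → ℝ := fun j i => D (x j i) (x j (i + 1)) / ℓ j
  have hpow : ∀ j : ℕ, (2 : ℝ) ^ (j * 𝔪) = (M : ℝ) ^ j := fun j => by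
    rw [hMr, ← pow_mul, mul_comm]
  have hℓ0 : ∀ j, 0 < ℓ j := fun j => by positivity
  have hℓM : ∀ j, ℓ j = M * ℓ (j + 1) := fun j => by
    simp only [ℓ, hpow, pow_succ]; field_simp
  have hℓn : ∀ j, (M : ℝ) ^ j * ℓ j = n := fun j => by
    simp only [ℓ, hpow]; field_simp
  have hℓrt : ∀ j ≤ J₁ + T, Real.sqrt n ≤ ℓ j := by
    intro j hj
    have h1 : (2 : ℝ) ^ (j * 𝔪) ≤ Real.sqrt n := by
      apply Real.le_sqrt_of_sq_le
      calc ((2 : ℝ) ^ (j * 𝔪)) ^ 2 ≤ (2 ^ ((J₁ + T) * 𝔪)) ^ 2 := by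
            gcongr; norm_num
        _ = 4 ^ ((J₁ + T) * 𝔪) := by rw [← pow_mul, mul_comm, pow_mul]; norm_num
        _ ≤ n := by exact_mod_cast hn
    rw [le_div_iff₀ (by positivity)]
    calc Real.sqrt n * 2 ^ (j * 𝔪) ≤ Real.sqrt n * Real.sqrt n := by gcongr
      _ = n := Real.mul_self_sqrt hn0.le
  have hf : ∀ j ≤ J₁ + T, ∀ i < M ^ j, α ≤ f j i ∧ f j i ≤ 3 * b := by
    intro j hj i hi
    have hi' : (i : ℝ) + 1 ≤ M ^ j := by exact_mod_cast hi
    have := hD.step_bounds hz hθ (hℓ0 j).le (hℓrt j hj)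
      (show 0 ≤ (i : ℝ) * ℓ j from mul_nonneg (by positivity) (hℓ0 j).le)
      (by rw [← hℓn j]; nlinarith [hℓ0 j])
    rw [show (i : ℝ) * ℓ j + ℓ j = ((i + 1 : ℕ) : ℝ) * ℓ j by push_cast; ring] at this
    exact ⟨(le_div_iff₀ (hℓ0 j)).2 this.1, (div_le_iff₀ (hℓ0 j)).2 this.2⟩
  have hx : ∀ j a, x j a = x (j + 1) (a * M) := fun j a => by
    simp only [x, hℓM j]; push_cast; rw [mul_assoc]
  have hsub : ∀ j a, M * f j a ≤ ∑ r ∈ Finset.range M, f (j + 1) (a * M + r) := by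
    intro j a
    have h := dist_le_sum_steps hD.2.1 (x (j + 1)) (a * M) M hM1
    rw [← Finset.sum_div, le_div_iff₀ (hℓ0 _)]
    refine le_trans (le_of_eq ?_) h
    rw [← Nat.succ_mul, ← hx, ← hx, mul_right_comm, ← hℓM, mul_div_cancel₀ _ (hℓ0 j).ne']
  let E : ℕ → ℝ := fun j => (∑ i ∈ Finset.range (M ^ j), f j i ^ 2) / M ^ j
  obtain ⟨t, htT, ht⟩ := exists_increment_le E ((3 * b) ^ 2) J₁ T hT1
    (div_nonneg (Finset.sum_nonneg fun _ _ => sq_nonneg _) (by positivity)) (by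
      rw [div_le_iff₀ (by positivity)]
      calc _ ≤ ∑ _i ∈ Finset.range (M ^ (J₁ + T)), (3 * b) ^ 2 := by
            refine Finset.sum_le_sum fun i hi => ?_
            have := hf _ le_rfl i (Finset.mem_range.1 hi)
            have h0 := hα.le.trans this.1
            gcongr
            exact this.2
        _ = _ := by simp [mul_comm])
  obtain ⟨j, hj⟩ : ∃ j, j = J₁ + t := ⟨_, rfl⟩
  rw [← hj] at ht
  let S : Finset ℕ := (Finset.range (M ^ j)).filter
    fun a => ∃ r < M, η < |f (j + 1) (a * M + r) - f j a|
  have hS : (S.card : ℝ) * M ≤ δ₂ * M ^ (j + 1) := by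
    have h1 := card_filter_exists_mul_sq_le
      (fun a r => f (j + 1) (a * M + r) - f j a) (M ^ j) M η hη0.le
    have h2 := sum_sq_sub_le (f j) (f (j + 1)) (M ^ j) M
      (fun a ha => hα.le.trans (hf j (by omega) a ha).1) (fun a _ => hsub j a)
    rw [← pow_succ] at h2
    have h3 : ∑ i ∈ Finset.range (M ^ (j + 1)), f (j + 1) i ^ 2 -
        M * ∑ a ∈ Finset.range (M ^ j), f j a ^ 2 = M ^ (j + 1) * (E (j + 1) - E j) := by
      simp only [E, pow_succ]; field_simp
    have h4 : (S.card : ℝ) * η ^ 2 ≤ M ^ (j + 1) * ((3 * b) ^ 2 / T) :=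
      (h1.trans h2).trans (h3.trans_le (by gcongr))
    have h5 : M * ((3 * b) ^ 2 / T) ≤ η ^ 2 * δ₂ := by
      have : M * (3 * b) ^ 2 / (η ^ 2 * δ₂) ≤ T := by linarith
      rw [div_le_iff₀ (by positivity)] at this
      rw [← mul_div_assoc, div_le_iff₀ hT0]
      linarith
    refine le_of_mul_le_mul_right ?_ (show 0 < η ^ 2 by positivity)
    calc (S.card : ℝ) * M * η ^ 2 = S.card * η ^ 2 * M := by ring
      _ ≤ M ^ (j + 1) * ((3 * b) ^ 2 / T) * M := by gcongr
      _ = M ^ (j + 1) * (M * ((3 * b) ^ 2 / T)) := by ring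
      _ ≤ M ^ (j + 1) * (η ^ 2 * δ₂) := by gcongr
      _ = _ := by ring
  refine ⟨j + 1, by omega, ?_, ?_⟩
  · have : ((j + 1 : ℕ) : ℝ) ≤ J₁ + T := by exact_mod_cast (by omega : j + 1 ≤ J₁ + T)
    linarith
  have hcard := ncard_le_of_block_cover
    (fun i => ¬ StablePt D δ₂ θ (ℓ (j + 1)) k (x (j + 1) i)) S (M ^ j) M k hM1 (by
      intro a ha haS r hrk hrM
      rw [not_not]
      intro k' hk' hk'k
      have hk'k : k' ≤ k := by exact_mod_cast hk'k
      have hnear : ∀ s < M, |f (j + 1) (a * M + s) - f j a| ≤ η := by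
        simpa [S, ha] using haS
      have h := stable_of_steps_near hD.2.1 (x (j + 1)) (a * M) M (ℓ (j + 1)) (f j a) η δ₂
        (hℓ0 _).le hη0.le hδ
        (by rw [← Nat.succ_mul, ← hx, ← hx, mul_left_comm, ← hℓM,
              div_mul_cancel₀ _ (hℓ0 j).ne'])
        (by
          rw [hη, div_mul_cancel₀ _ (by positivity)]
          exact mul_le_mul_of_nonneg_left (hf j (by omega) a ha).1 hδ.le)
        (fun s hs => by
          have := mul_le_mul_of_nonneg_right (hnear s hs) (hℓ0 (j + 1)).le
          rwa [← abs_of_pos (hℓ0 (j + 1)), ← abs_mul, abs_of_pos (hℓ0 (j + 1)), sub_mul,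
            div_mul_cancel₀ _ (hℓ0 (j + 1)).ne'] at this)
        r k' hk' (by omega)
      have hxs : ∀ i s : ℕ, x (j + 1) i + ((s : ℝ) * ℓ (j + 1)) • θ = x (j + 1) (i + s) := by
        intro i s
        simp only [x]; push_cast; module
      rw [hxs, show x (j + 1) (a * M + r) + ℓ (j + 1) • θ = x (j + 1) (a * M + r + 1) by
        simpa using hxs (a * M + r) 1]
      exact h)
  rw [← pow_succ] at hcard
  have hpowN : 2 ^ ((j + 1) * 𝔪) = M ^ (j + 1) := by rw [hM, ← pow_mul, mul_comm]
  have hk2 : (M : ℝ) ^ j * k ≤ δ₂ * M ^ (j + 1) := by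
    rw [pow_succ]
    nlinarith [mul_le_mul_of_nonneg_left hMk (show (0 : ℝ) ≤ M ^ j by positivity)]
  have h1 : (1 : ℝ) ≤ δ₂ * M ^ (j + 1) := by
    have : (1 : ℝ) ≤ M ^ j := one_le_pow₀ (by exact_mod_cast hM1)
    nlinarith
  calc _ ≤ ((S.card * M + M ^ j * k + 1 : ℕ) : ℝ) := by
        rw [← hpowN] at hcard
        exact Nat.cast_le.2 hcard
    _ = S.card * M + M ^ j * k + 1 := by push_cast; rfl
    _ ≤ 3 * δ₂ * (2 ^ ((j + 1) * 𝔪) + 1) := by rw [hpow]; linarith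
end
end
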